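/- For a ≥ 0 let q(a) := ∑_{b=a+1}^∞ p(b)·P(Bin(b−1,ρ)=a). Let T(d^n) be the tree built by Pitman's additive coalescent with degree sequence d^n, let c^n = (c^n(i), 1 ≤ i ≤ n) be its child sequence, let Q_{c^n}(a) = #{i ∈ [n] : c^n(i) = a}, and for 0 ≤ a < b let P^n_{b,a} = #{i ∈ [n] : d^n(i) = b and c^n(i) = a}. Then: (i) μ2(q) < ∞; (ii) μ2(n^{−1}Q_{c^n}) → μ2(q) in probability as n → ∞; (iii) for all 0 ≤ a < b, n^{−1}P^n_{b,a} → p(b)·P(Bin(b−1,ρ)=a) in probability; and (iv) for all a ≥ 0, n^{−1}Q_{c^n}(a) → q(a) in probability. -/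

import Mathlib

open Classical Filter

namespace TWG

/-- Half-edges for the degree sequence `d`: vertex `i` carries `d i` half-edges,
encoded as `⟨i, j⟩` for `j : Fin (d i)`; `⟨i, d i - 1⟩` is the root half-edge of `i`. -/
abbrev HE {n : ℕ} (d : Fin n → ℕ) := (i : Fin n) × Fin (d i)

def IsRootHE {n : ℕ} (d : Fin n → ℕ) (h : HE d) : Prop := (h.2 : ℕ) = d h.1 - 1

def IsNonRootHE {n : ℕ} (d : Fin n → ℕ) (h : HE d) : Prop := (h.2 : ℕ) < d h.1 - 1

/-- A candidate execution path: at each of the `n-1` steps, a pair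
(root half-edge `r_k`, non-root half-edge `s_k`) is chosen. -/
abbrev Path {n : ℕ} (d : Fin n → ℕ) := Fin (n - 1) → HE d × HE d

/-- Vertices `a` and `b` lie in the same tree of the forest present at the start of
step `k`, i.e. they are joined by the edges created at steps `j < k`. -/
def SameTree {n : ℕ} {d : Fin n → ℕ} (E : Path d) (k : Fin (n - 1)) (a b : Fin n) : Prop :=
  Relation.ReflTransGen
    (fun x y => ∃ j, j < k ∧
      (((E j).1.1 = x ∧ (E j).2.1 = y) ∨ ((E j).1.1 = y ∧ (E j).2.1 = x))) a b

/-- `E` is a valid execution path of Pitman's additive coalescent for `d`: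
at each step, `r_k` is an as-yet-unpaired root half-edge, `s_k` is an
as-yet-unpaired non-root half-edge, and they lie in different trees of the
current forest. -/
def IsExecPath {n : ℕ} (d : Fin n → ℕ) (E : Path d) : Prop :=
  ∀ k : Fin (n - 1),
    IsRootHE d (E k).1 ∧ IsNonRootHE d (E k).2 ∧
    (∀ j, j < k → (E j).1 ≠ (E k).1) ∧
    (∀ j, j < k → (E j).2 ≠ (E k).2) ∧
    ¬ SameTree E k (E k).1.1 (E k).2.1

/-- The number of children of vertex `i` in the tree `T(d)` built by `E`. -/
noncomputable def cc {n : ℕ} {d : Fin n → ℕ} (E : Path d) (i : Fin n) : ℕ :=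
  Nat.card {k : Fin (n - 1) // (E k).2.1 = i}

/-- `v` is a non-root vertex of the tree built by `E`. -/
def IsNonRootV {n : ℕ} {d : Fin n → ℕ} (E : Path d) (v : Fin n) : Prop :=
  ∃ k, (E k).1.1 = v

/-- The parent of `v` in the tree built by `E` (equal to `v` itself for the root). -/
noncomputable def parentOf {n : ℕ} {d : Fin n → ℕ} (E : Path d) (v : Fin n) : Fin n :=
  if h : ∃ k, (E k).1.1 = v then (E h.choose).2.1 else v

/-- The tree built by `E` is the rooted tree with root `root` and parent map `par`. -/
def TreeEq {n : ℕ} {d : Fin n → ℕ} (E : Path d) (root : Fin n) (par : Fin n → Fin n) : Prop :=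
  (∀ k, par (E k).1.1 = (E k).2.1) ∧ ∀ v, v ≠ root → ∃ k, (E k).1.1 = v

/-- `(root, par)` encodes a rooted tree on `Fin n`: the root is a fixed point of the
parent map and every vertex reaches the root by iterating the parent map. -/
def IsRootedTree {n : ℕ} (root : Fin n) (par : Fin n → Fin n) : Prop :=
  par root = root ∧ ∀ v, ∃ m, par^[m] v = root

/-- The number of children of `i` in the rooted tree `(root, par)`. -/
noncomputable def childCount {n : ℕ} (root : Fin n) (par : Fin n → Fin n) (i : Fin n) : ℕ :=
  Nat.card {v : Fin n // v ≠ root ∧ par v = i}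

/-- `h` is one of the half-edges paired during the execution path `E`. -/
def UsedIn {n : ℕ} {d : Fin n → ℕ} (E : Path d) (h : HE d) : Prop :=
  (∃ k, (E k).1 = h) ∨ (∃ k, (E k).2 = h)

/-- `M` pairs up, as a fixed-point-free involution, exactly the half-edges left
unpaired by `E` (its fixed points are exactly the half-edges used by `E`). -/
def IsCompletion {n : ℕ} {d : Fin n → ℕ} (E : Path d) (M : HE d → HE d) : Prop :=
  Function.Involutive M ∧ ∀ h, (M h = h ↔ UsedIn E h)

/-- The number of half-edges at `u`, unpaired by `E`, which `M` matches to a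
half-edge at `v`.  For `u ≠ v` this is the number of `M`-edges joining `u` and `v`;
for `u = v` it is twice the number of `M`-loops at `u`. -/
noncomputable def matchCount {n : ℕ} {d : Fin n → ℕ} (E : Path d) (M : HE d → HE d)
    (u v : Fin n) : ℕ :=
  Nat.card {h : HE d // ¬ UsedIn E h ∧ h.1 = u ∧ (M h).1 = v}

/-- `P(Bin(m, ρ) = a)`. -/
noncomputable def binomP (ρ : ℝ) (m a : ℕ) : ℝ :=
  (m.choose a : ℝ) * ρ ^ a * (1 - ρ) ^ (m - a)


/-- `μ₁(p) = ∑ k, k⋅p(k)`. -/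
noncomputable def mu1 (p : ℕ → ℝ) : ℝ := ∑' k : ℕ, (k : ℝ) * p k

/-- `ρ = 1/(μ₁(p) - 1)`. -/
noncomputable def rho (p : ℕ → ℝ) : ℝ := 1 / (mu1 p - 1)

/-- `q(a) = ∑_{b > a} p(b) ⋅ P(Bin(b-1, ρ) = a)`. -/
noncomputable def qfun (p : ℕ → ℝ) (a : ℕ) : ℝ :=
  ∑' b : ℕ, if a < b then p b * binomP (rho p) (b - 1) a else 0

section Count

variable {V : Type*} {N : ℕ}

/-- Connectivity by the first `k` edges. -/
def Rel (r s : Fin N → V) (k : ℕ) (a b : V) : Prop :=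
  Relation.ReflTransGen
    (fun x y => ∃ j : Fin N, (j : ℕ) < k ∧ ((r j = x ∧ s j = y) ∨ (r j = y ∧ s j = x))) a b

/-- Step `k` is allowed. -/
def StepOK (r s : Fin N → V) (k : Fin N) : Prop :=
  (∀ j, j < k → r j ≠ r k) ∧ ¬ Rel r s k (r k) (s k)

lemma Rel.symm' {r s : Fin N → V} {k : ℕ} {a b : V} (h : Rel r s k a b) : Rel r s k b a := by
  unfold Rel at *
  induction h with
  | refl => exact Relation.ReflTransGen.refl
  | tail _ e ih =>
    obtain ⟨j, hj, h⟩ := e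
    exact Relation.ReflTransGen.head ⟨j, hj, h.symm⟩ ih

lemma Rel.mono' {r s : Fin N → V} {k l : ℕ} (hkl : k ≤ l) {a b : V} (h : Rel r s k a b) :
    Rel r s l a b := by
  unfold Rel at *
  induction h with
  | refl => exact Relation.ReflTransGen.refl
  | tail _ e ih =>
    obtain ⟨j, hj, h⟩ := e
    exact Relation.ReflTransGen.tail ih ⟨j, by omega, h⟩

lemma Rel.congr' {r r' s : Fin N → V} {k : ℕ} (h : ∀ j : Fin N, (j : ℕ) < k → r j = r' j)
    {a b : V} : Rel r s k a b ↔ Rel r' s k a b := by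
  unfold Rel
  have : (fun x y => ∃ j : Fin N, (j : ℕ) < k ∧ ((r j = x ∧ s j = y) ∨ (r j = y ∧ s j = x)))
    = (fun x y => ∃ j : Fin N, (j : ℕ) < k ∧ ((r' j = x ∧ s j = y) ∨ (r' j = y ∧ s j = x))) := by
    funext x y
    apply propext
    constructor
    · rintro ⟨j, hj, h2⟩
      exact ⟨j, hj, by rw [← h j hj]; exact h2⟩
    · rintro ⟨j, hj, h2⟩
      exact ⟨j, hj, by rw [h j hj]; exact h2⟩
  rw [this]

lemma StepOK.congr' {r r' s : Fin N → V} {k : Fin N} (h : ∀ j : Fin N, j ≤ k → r j = r' j) :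
    StepOK r s k ↔ StepOK r' s k := by
  unfold StepOK
  rw [Rel.congr' (r := r) (r' := r') (fun j hj => h j (le_of_lt hj)), h k le_rfl]
  refine and_congr_left fun _ => ?_
  refine forall_congr' fun j => imp_congr_right fun hj => ?_
  rw [h j hj.le]

lemma exists_root (r s : Fin N → V) (k : ℕ) (hk : k ≤ N)
    (h : ∀ j : Fin N, (j : ℕ) < k → StepOK r s j) :
    ∃ f : V → V, (∀ x y, Rel r s k x y ↔ f x = f y) ∧
      (∀ v, ∀ j : Fin N, (j : ℕ) < k → r j ≠ f v) ∧
      (∀ w, (∀ j : Fin N, (j : ℕ) < k → r j ≠ w) → f w = w) := by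
  induction k with
  | zero =>
    refine ⟨id, ?_, ?_, ?_⟩
    · intro x y
      constructor
      · intro h
        unfold Rel at h
        induction h with
        | refl => rfl
        | tail _ h2 _ => obtain ⟨j, hj, _⟩ := h2; omega
      · intro h
        have h : x = y := h
        subst h
        exact Relation.ReflTransGen.refl
    · intro v j hj; omega
    · intro w _; rfl
  | succ k ih =>
    obtain ⟨f, h1, h2, h3⟩ := ih (by omega) (fun j hj => h j (by omega))
    set K : Fin N := ⟨k, by omega⟩ with hK
    obtain ⟨hr, hR⟩ := h K (by simp [hK])
    have hfr : f (r K) = r K := h3 _ (fun j hj => hr j hj)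
    have hne : f (s K) ≠ r K := by
      intro h
      apply hR
      exact (h1 _ _).2 (by rw [hfr, h])
    refine ⟨fun x => if f x = r K then f (s K) else f x, ?_, ?_, ?_⟩
    · intro x y
      constructor
      · intro h
        unfold Rel at h
        induction h with
        | refl => rfl
        | @tail y z _ e ih =>
          rw [ih]
          obtain ⟨j, hj, hh⟩ := e
          rcases Nat.lt_succ_iff_lt_or_eq.1 hj with hj | hj
          · have : f y = f z := (h1 _ _).1 (Relation.ReflTransGen.single ⟨j, hj, hh⟩)
            simp only [this]
          · have hjK : j = K := Fin.ext hj
            subst hjK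
            rcases hh with ⟨rfl, rfl⟩ | ⟨rfl, rfl⟩ <;> simp [hfr, hne]
      · intro hxy
        have e : Rel r s (k+1) (r K) (s K) :=
          Relation.ReflTransGen.single ⟨K, by simp [hK], Or.inl ⟨rfl, rfl⟩⟩
        have key : ∀ x, Rel r s (k+1) x (if f x = r K then f (s K) else f x) := by
          intro x
          have idem : ∀ v, f (f v) = f v := fun v => h3 _ (h2 v)
          split_ifs with hx
          · have a : Rel r s (k+1) x (r K) :=
              Rel.mono' (by omega) ((h1 _ _).2 (by rw [hx, hfr]))
            have b : Rel r s (k+1) (s K) (f (s K)) :=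
              Rel.mono' (by omega) ((h1 _ _).2 (by rw [idem]))
            exact Relation.ReflTransGen.trans a (Relation.ReflTransGen.trans e b)
          · exact Rel.mono' (by omega) ((h1 _ _).2 (by rw [idem]))
        have hx := key x
        have hy := key y
        have hxy' : (if f x = r K then f (s K) else f x) = (if f y = r K then f (s K) else f y) :=
          hxy
        rw [hxy'] at hx
        exact Relation.ReflTransGen.trans hx (Rel.symm' hy)
    · intro v j hj
      rcases Nat.lt_succ_iff_lt_or_eq.1 hj with hj | hj
      · dsimp only
        split_ifs
        · exact h2 _ j hj
        · exact h2 _ j hj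
      · have hjK : j = K := Fin.ext hj
        subst hjK
        dsimp only
        split_ifs with hx
        · exact hne.symm
        · exact fun h => hx h.symm
    · intro w hw
      have hfw : f w = w := h3 _ (fun j hj => hw j (by omega))
      have : w ≠ r K := (hw K (by simp [hK])).symm
      simp [hfw, this]

variable [Fintype V]

lemma card_next (r s : Fin N → V) (k : ℕ) (hk : k ≤ N)
    (h : ∀ j : Fin N, (j : ℕ) < k → StepOK r s j) (v : V) :
    (Finset.univ.filter (fun w : V =>
      (∀ j : Fin N, (j : ℕ) < k → r j ≠ w) ∧ ¬ Rel r s k w v)).card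
      = Fintype.card V - k - 1 := by
  obtain ⟨f, h1, h2, h3⟩ := exists_root r s k hk h
  have e : (Finset.univ.filter (fun w : V =>
      (∀ j : Fin N, (j : ℕ) < k → r j ≠ w) ∧ ¬ Rel r s k w v))
      = ((((Finset.univ.filter (fun j : Fin N => (j : ℕ) < k)).image r)ᶜ).erase (f v)) := by
    ext w
    simp only [Finset.mem_filter, Finset.mem_univ, true_and, Finset.mem_erase, Finset.mem_compl,
      Finset.mem_image, not_exists, not_and]
    constructor
    · rintro ⟨a, b⟩
      refine ⟨fun hw => b ((h1 _ _).2 ?_), a⟩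
      rw [h3 w a, hw]
    · rintro ⟨a, b⟩
      refine ⟨b, fun hw => a ?_⟩
      rw [← (h1 _ _).1 hw, h3 w b]
  rw [e, Finset.card_erase_of_mem, Finset.card_compl, Finset.card_image_of_injOn]
  · congr 2
    rw [show (Finset.univ.filter (fun j : Fin N => (j : ℕ) < k)).card = k from ?_]
    have := Fin.card_filter_val_lt (n := N) (m := k)
    simpa [hk] using this
  · intro i hi j hj hij
    simp only [Finset.coe_filter, Finset.mem_univ, true_and, Set.mem_ofPred_eq] at hi hj
    by_contra hne
    rcases lt_or_gt_of_ne hne with hl | hl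
    · exact (h j hj).1 i hl hij
    · exact (h i hi).1 j hl hij.symm
  · simp only [Finset.mem_compl, Finset.mem_image, Finset.mem_filter, Finset.mem_univ, true_and,
      not_exists, not_and]
    exact h2 v

lemma card_valid [Nonempty V] (s : Fin N → V) :
    (Finset.univ.filter (fun r : Fin N → V => ∀ j, StepOK r s j)).card
      = ∏ k ∈ Finset.range N, (Fintype.card V - k - 1) := by
  let v0 : V := Classical.arbitrary V
  let A : ℕ → Finset (Fin N → V) := fun k => Finset.univ.filter (fun r : Fin N → V =>
    (∀ j : Fin N, (j : ℕ) < k → StepOK r s j) ∧ ∀ j : Fin N, k ≤ (j : ℕ) → r j = v0)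
  have hA : ∀ k, k ≤ N → (A k).card = ∏ k ∈ Finset.range k, (Fintype.card V - k - 1) := by
    intro k
    induction k with
    | zero =>
      intro _
      have : A 0 = {fun _ => v0} := by
        ext r
        simp [A, funext_iff]
      simp [this]
    | succ k ih =>
      intro hk
      rw [Finset.prod_range_succ, ← ih (by omega)]
      set K : Fin N := ⟨k, by omega⟩ with hK
      have hcard : ((A k).sigma (fun r => Finset.univ.filter (fun w : V =>
          (∀ j : Fin N, (j : ℕ) < k → r j ≠ w) ∧ ¬ Rel r s k w (s K)))).card
          = (A k).card * (Fintype.card V - k - 1) := by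
        rw [Finset.card_sigma]
        rw [Finset.sum_congr rfl (fun r hr => card_next r s k (by omega) ?_ (s K))]
        · simp
        · simp only [A, Finset.mem_filter] at hr
          exact hr.2.1
      rw [← hcard]
      symm
      refine Finset.card_bij' (fun x _ => Function.update x.1 K x.2)
        (fun r _ => ⟨Function.update r K v0, r K⟩) ?_ ?_ ?_ ?_
      · rintro ⟨r, w⟩ hx
        simp only [A, Finset.mem_sigma, Finset.mem_filter, Finset.mem_univ, true_and] at hx ⊢
        obtain ⟨⟨ha, hb⟩, hc, hd⟩ := hx
        have hagree : ∀ j : Fin N, (j : ℕ) < k → r j = Function.update r K w j := by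
          intro j hj
          rw [Function.update_of_ne]
          intro h; rw [h, hK] at hj; simp at hj
        refine ⟨?_, ?_⟩
        · intro j hj
          rcases Nat.lt_succ_iff_lt_or_eq.1 hj with hj | hj
          · refine (StepOK.congr' (r' := r) (fun i hi => (hagree i ?_).symm)).2 (ha j hj)
            exact lt_of_le_of_lt hi hj
          · have hjK : j = K := Fin.ext hj
            subst hjK
            refine ⟨?_, ?_⟩
            · intro i hi
              rw [← hagree i hi, Function.update_self]
              exact hc i hi
            · rw [← Rel.congr' (fun i hi => hagree i hi), Function.update_self]
              exact hd
        · intro j hj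
          rw [Function.update_of_ne, hb j (by omega)]
          intro h; rw [h, hK] at hj; simp at hj
      · intro r hr
        simp only [A, Finset.mem_sigma, Finset.mem_filter, Finset.mem_univ, true_and] at hr ⊢
        obtain ⟨ha, hb⟩ := hr
        have hagree : ∀ j : Fin N, (j : ℕ) < k → r j = Function.update r K v0 j := by
          intro j hj
          rw [Function.update_of_ne]
          intro h; rw [h, hK] at hj; simp at hj
        have hKok := ha K (by simp [hK])
        refine ⟨⟨?_, ?_⟩, ?_, ?_⟩
        · intro j hj
          refine (StepOK.congr' (r' := r) (fun i hi => (hagree i ?_).symm)).2 (ha j (by omega))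
          exact lt_of_le_of_lt hi hj
        · intro j hj
          by_cases h : j = K
          · rw [h, Function.update_self]
          · rw [Function.update_of_ne h]
            apply hb
            have : (j : ℕ) ≠ k := fun h' => h (Fin.ext h')
            omega
        · intro j hj
          rw [← hagree j hj]
          exact hKok.1 j hj
        · rw [← Rel.congr' (fun i hi => hagree i hi)]
          exact hKok.2
      · rintro ⟨r, w⟩ hx
        simp only [A, Finset.mem_sigma, Finset.mem_filter, Finset.mem_univ, true_and] at hx
        have : r K = v0 := hx.1.2 K (by simp [hK])
        simp [← this]
      · intro r _
        simp
  have hN := hA N le_rfl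
  rw [← hN]
  congr 1
  ext r
  simp only [A, Finset.mem_filter, Finset.mem_univ, true_and]
  constructor
  · intro h
    exact ⟨fun j _ => h j, fun j hj => absurd j.2 (by omega)⟩
  · intro h j
    exact h.1 j j.2

end Count

section Fibers

variable {n : ℕ}

/-- The set of non-root half-edges. -/
noncomputable def NR (d : Fin n → ℕ) : Finset (HE d) :=
  Finset.univ.filter (fun h => IsNonRootHE d h)

lemma mem_NR {d : Fin n → ℕ} (h : HE d) : h ∈ NR d ↔ (h.2 : ℕ) < d h.1 - 1 := by
  rw [NR, Finset.mem_filter]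
  simp [IsNonRootHE]

/-- The set of non-root half-edges used by a path. -/
noncomputable def im {d : Fin n → ℕ} (E : Path d) : Finset (HE d) :=
  Finset.univ.image (fun k => (E k).2)

/-- The sample space. -/
noncomputable def Om (d : Fin n → ℕ) : Finset (Finset (HE d)) :=
  (NR d).powersetCard (n - 1)

/-- Number of selected half-edges at `i`. -/
noncomputable def cT {d : Fin n → ℕ} (T : Finset (HE d)) (i : Fin n) : ℕ :=
  (T.filter (fun h => h.1 = i)).card

lemma exec_inj {d : Fin n → ℕ} {E : Path d} (hE : IsExecPath d E) :
    Function.Injective (fun k => (E k).2) := by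
  intro i j hij
  by_contra hne
  rcases lt_or_gt_of_ne hne with hl | hl
  · exact (hE j).2.2.2.1 i hl hij
  · exact (hE i).2.2.2.1 j hl hij.symm

lemma im_mem {d : Fin n → ℕ} {E : Path d} (hE : IsExecPath d E) : im E ∈ Om d := by
  rw [Om, Finset.mem_powersetCard]
  refine ⟨?_, ?_⟩
  · intro h hh
    simp only [im, Finset.mem_image, Finset.mem_univ, true_and] at hh
    obtain ⟨k, rfl⟩ := hh
    simp only [NR, Finset.mem_filter, Finset.mem_univ, true_and]
    exact (hE k).2.1
  · rw [im, Finset.card_image_of_injective _ (exec_inj hE)]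
    simp

lemma cc_eq {d : Fin n → ℕ} {E : Path d} (hE : IsExecPath d E) (i : Fin n) :
    cc E i = cT (im E) i := by
  rw [cc, cT, im, Finset.filter_image, Finset.card_image_of_injective _ (exec_inj hE),
    Nat.card_eq_fintype_card, Fintype.card_subtype]

lemma card_fiber (hn : 1 ≤ n) {d : Fin n → ℕ} (hd : ∀ i, 1 ≤ d i) (s : Fin (n - 1) → HE d)
    (hs : Function.Injective s) (hnr : ∀ k, IsNonRootHE d (s k)) :
    (Finset.univ.filter (fun E : Path d => IsExecPath d E ∧ (fun k => (E k).2) = s)).card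
      = ∏ k ∈ Finset.range (n - 1), (n - k - 1) := by
  have : Nonempty (Fin n) := ⟨⟨0, by omega⟩⟩
  have := card_valid (V := Fin n) (N := n - 1) (fun k => (s k).1)
  rw [Fintype.card_fin] at this
  rw [← this]
  refine Finset.card_bij' (fun E _ k => (E k).1.1)
    (fun r _ k => (⟨r k, ⟨d (r k) - 1, Nat.sub_lt (hd _) one_pos⟩⟩, s k)) ?_ ?_ ?_ ?_
  · intro E hE
    simp only [Finset.mem_filter, Finset.mem_univ, true_and] at hE ⊢
    obtain ⟨hE, rfl⟩ := hE
    intro k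
    obtain ⟨h1, h2, h3, h4, h5⟩ := hE k
    refine ⟨?_, h5⟩
    intro j hj h
    apply h3 j hj
    have h1' := (hE j).1
    unfold IsRootHE at h1 h1'
    have h : (E j).1.1 = (E k).1.1 := h
    generalize (E j).1 = x at *
    generalize (E k).1 = y at *
    obtain ⟨x1, x2⟩ := x
    obtain ⟨y1, y2⟩ := y
    dsimp only at *
    subst h
    congr 1
    apply Fin.ext
    rw [h1, h1']
  · intro r hr
    simp only [Finset.mem_filter, Finset.mem_univ, true_and] at hr ⊢
    refine ⟨?_, trivial⟩
    intro k
    refine ⟨rfl, hnr k, ?_, ?_, (hr k).2⟩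
    · intro j hj h
      exact (hr k).1 j hj (congrArg Sigma.fst h)
    · intro j hj h
      exact hj.ne (hs h)
  · intro E hE
    simp only [Finset.mem_filter, Finset.mem_univ, true_and] at hE
    obtain ⟨hE, rfl⟩ := hE
    funext k
    have h1 := (hE k).1
    unfold IsRootHE at h1
    refine Prod.ext ?_ rfl
    exact Sigma.ext rfl (heq_of_eq (Fin.ext h1.symm))
  · intro r _
    rfl

lemma card_inj_image {H : Type*} [Fintype H] [DecidableEq H] {N : ℕ} (T : Finset H) (hT : T.card = N) :
    (Finset.univ.filter (fun s : Fin N → H => Function.Injective s ∧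
      Finset.univ.image s = T)).card = N.factorial := by
  have h : Fintype.card (Fin N ↪ T) = N.factorial := by
    rw [Fintype.card_embedding_eq]
    simp [hT, Nat.descFactorial_self]
  rw [← h, ← Finset.card_univ]
  symm
  refine Finset.card_bij (fun e _ k => (e k : H)) ?_ ?_ ?_
  · intro e _
    simp only [Finset.mem_filter, Finset.mem_univ, true_and]
    have hi : Function.Injective (fun k => (e k : H)) :=
      Subtype.val_injective.comp e.injective
    refine ⟨hi, ?_⟩
    apply Finset.eq_of_subset_of_card_le
    · intro x hx
      simp only [Finset.mem_image, Finset.mem_univ, true_and] at hx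
      obtain ⟨k, rfl⟩ := hx
      exact (e k).2
    · rw [Finset.card_image_of_injective _ hi]
      simp [hT]
  · intro e _ e' _ h
    ext k
    exact congrFun h k
  · intro s hs
    simp only [Finset.mem_filter, Finset.mem_univ, true_and] at hs
    obtain ⟨hs, rfl⟩ := hs
    refine ⟨⟨fun k => ⟨s k, by simp⟩, ?_⟩, Finset.mem_univ _, rfl⟩
    intro i j h
    exact hs (congrArg Subtype.val h)

lemma card_exec_im (hn : 1 ≤ n) {d : Fin n → ℕ} (hd : ∀ i, 1 ≤ d i) (T : Finset (HE d))
    (hT : T ∈ Om d) :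
    (Finset.univ.filter (fun E : Path d => IsExecPath d E ∧ im E = T)).card
      = (n - 1).factorial * ∏ k ∈ Finset.range (n - 1), (n - k - 1) := by
  rw [Om, Finset.mem_powersetCard] at hT
  rw [← card_inj_image T hT.2]
  rw [Finset.card_eq_sum_card_fiberwise (f := fun E : Path d => fun k => (E k).2)
    (t := Finset.univ.filter (fun s : Fin (n - 1) → HE d => Function.Injective s ∧
      Finset.univ.image s = T))]
  · rw [Finset.sum_const_nat (m := ∏ k ∈ Finset.range (n - 1), (n - k - 1))]
    intro s hs
    simp only [Finset.mem_filter, Finset.mem_univ, true_and] at hs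
    rw [← card_fiber hn hd s hs.1]
    · congr 1
      ext E
      simp only [Finset.mem_filter, Finset.mem_univ, true_and]
      constructor
      · rintro ⟨⟨a, b⟩, c⟩
        exact ⟨a, c⟩
      · rintro ⟨a, c⟩
        refine ⟨⟨a, ?_⟩, c⟩
        rw [im, c, hs.2]
    · intro k
      have : s k ∈ NR d := hT.1 (by rw [← hs.2]; simp)
      simpa [NR] using this
  · intro E hE
    simp only [Finset.coe_filter, Finset.mem_univ, true_and, Set.mem_ofPred_eq] at hE ⊢
    exact ⟨exec_inj hE.1, hE.2⟩

lemma card_exec (hn : 1 ≤ n) {d : Fin n → ℕ} (hd : ∀ i, 1 ≤ d i) (Q : Finset (HE d) → Prop) :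
    Nat.card {E : Path d // IsExecPath d E ∧ Q (im E)}
      = ((Om d).filter Q).card *
        ((n - 1).factorial * ∏ k ∈ Finset.range (n - 1), (n - k - 1)) := by
  rw [Nat.card_eq_fintype_card, Fintype.card_subtype]
  rw [Finset.card_eq_sum_card_fiberwise (f := im) (t := (Om d).filter Q)]
  · rw [Finset.sum_const_nat]
    intro T hT
    simp only [Finset.mem_filter] at hT
    rw [← card_exec_im hn hd T hT.1]
    congr 1
    ext E
    simp only [Finset.mem_filter, Finset.mem_univ, true_and]
    constructor
    · rintro ⟨⟨a, b⟩, c⟩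
      exact ⟨a, c⟩
    · rintro ⟨a, c⟩
      exact ⟨⟨a, c ▸ hT.2⟩, c⟩
  · intro E hE
    simp only [Finset.coe_filter, Finset.mem_univ, true_and, Set.mem_ofPred_eq] at hE ⊢
    exact ⟨im_mem hE.1, hE.2⟩

lemma ratio_exec (hn : 1 ≤ n) {d : Fin n → ℕ} (hd : ∀ i, 1 ≤ d i) (Q : Path d → Prop)
    (Q' : Finset (HE d) → Prop) (hQ : ∀ E, IsExecPath d E → (Q E ↔ Q' (im E))) :
    (Nat.card {E : Path d // IsExecPath d E ∧ Q E} : ℝ)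
        / (Nat.card {E : Path d // IsExecPath d E} : ℝ)
      = (((Om d).filter Q').card : ℝ) / ((Om d).card : ℝ) := by
  have h1 : Nat.card {E : Path d // IsExecPath d E ∧ Q E}
      = Nat.card {E : Path d // IsExecPath d E ∧ Q' (im E)} :=
    Nat.card_congr (Equiv.subtypeEquivRight fun E => and_congr_right fun h => hQ E h)
  have h2 : Nat.card {E : Path d // IsExecPath d E}
      = Nat.card {E : Path d // IsExecPath d E ∧ (fun _ => True) (im E)} :=
    Nat.card_congr (Equiv.subtypeEquivRight fun E => by simp)
  rw [h1, h2, card_exec hn hd, card_exec hn hd (fun _ => True)]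
  have hpos : 0 < ((n - 1).factorial * ∏ k ∈ Finset.range (n - 1), (n - k - 1)) := by
    refine Nat.mul_pos (Nat.factorial_pos _) (Finset.prod_pos ?_)
    intro k hk
    have := Finset.mem_range.1 hk
    omega
  rw [Finset.filter_true]
  push_cast
  rw [mul_div_mul_right]
  exact_mod_cast hpos.ne'

lemma card_NR (d : Fin n → ℕ) : (NR d).card = ∑ i, (d i - 1) := by
  have : NR d = Finset.univ.sigma (fun i => Finset.univ.filter (fun j : Fin (d i) =>
      (j : ℕ) < d i - 1)) := by
    ext ⟨i, j⟩
    simp [mem_NR]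
  rw [this, Finset.card_sigma]
  refine Finset.sum_congr rfl fun i _ => ?_
  rw [Fin.card_filter_val_lt]
  omega

/-- Non-root half-edges at a vertex. -/
noncomputable def Bl (d : Fin n → ℕ) (i : Fin n) : Finset (HE d) :=
  (NR d).filter (fun h => h.1 = i)

lemma card_Bl (d : Fin n → ℕ) (i : Fin n) : (Bl d i).card = d i - 1 := by
  have : Bl d i = (Finset.univ.filter (fun j : Fin (d i) =>
      (j : ℕ) < d i - 1)).map ⟨fun j => (⟨i, j⟩ : HE d), fun a b h => by simpa using h⟩ := by
    ext ⟨i', j⟩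
    simp only [Bl, mem_NR, Finset.mem_filter, Finset.mem_univ, true_and, Finset.mem_map]
    constructor
    · rintro ⟨h, rfl⟩
      exact ⟨j, h, rfl⟩
    · rintro ⟨j', h, h'⟩
      cases h'
      exact ⟨h, rfl⟩
  rw [this, Finset.card_map, Fin.card_filter_val_lt]
  omega

lemma cT_eq_inter {d : Fin n → ℕ} {T : Finset (HE d)} (hT : T ∈ Om d) (i : Fin n) :
    cT T i = (T ∩ Bl d i).card := by
  rw [Om, Finset.mem_powersetCard] at hT
  rw [cT]
  congr 1
  ext h
  simp only [Bl, Finset.mem_filter, Finset.mem_inter]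
  constructor
  · rintro ⟨a, b⟩; exact ⟨a, hT.1 a, b⟩
  · rintro ⟨a, _, b⟩; exact ⟨a, b⟩

lemma cT_le {d : Fin n → ℕ} {T : Finset (HE d)} (hT : T ∈ Om d) (i : Fin n) :
    cT T i ≤ d i - 1 := by
  rw [cT_eq_inter hT, ← card_Bl d i]
  exact Finset.card_le_card Finset.inter_subset_right

lemma card_inter_eq {H : Type*} [DecidableEq H] {S U A : Finset H} {N : ℕ} (hU : U ⊆ S) (hA : A ⊆ U)
    (hN : A.card ≤ N) :
    ((S.powersetCard N).filter (fun T => T ∩ U = A)).card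
      = (S.card - U.card).choose (N - A.card) := by
  rw [← Finset.card_sdiff_of_subset hU, ← Finset.card_powersetCard]
  refine Finset.card_bij' (fun T _ => T \ U) (fun T _ => T ∪ A) ?_ ?_ ?_ ?_
  · intro T hT
    simp only [Finset.mem_filter, Finset.mem_powersetCard] at hT ⊢
    obtain ⟨⟨h1, h2⟩, h3⟩ := hT
    refine ⟨Finset.sdiff_subset_sdiff h1 le_rfl, ?_⟩
    rw [Finset.card_sdiff, Finset.inter_comm, h3, h2]
  · intro T hT
    simp only [Finset.mem_filter, Finset.mem_powersetCard] at hT ⊢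
    obtain ⟨h1, h2⟩ := hT
    have hdis : Disjoint T U := Finset.disjoint_of_subset_left h1 Finset.sdiff_disjoint
    refine ⟨⟨?_, ?_⟩, ?_⟩
    · exact Finset.union_subset (h1.trans Finset.sdiff_subset) (hA.trans hU)
    · rw [Finset.card_union_of_disjoint (Finset.disjoint_of_subset_right hA hdis), h2]
      omega
    · rw [Finset.union_inter_distrib_right, Finset.disjoint_iff_inter_eq_empty.1 hdis,
        Finset.empty_union, Finset.inter_eq_left.2 hA]
  · intro T hT
    simp only [Finset.mem_filter, Finset.mem_powersetCard] at hT
    rw [← hT.2]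
    ext x; simp only [Finset.mem_union, Finset.mem_sdiff, Finset.mem_inter]; tauto
  · intro T hT
    simp only [Finset.mem_powersetCard] at hT
    ext x
    have h1 : x ∈ T → x ∉ U := fun h => (Finset.mem_sdiff.1 (hT.1 h)).2
    have h2 : x ∈ A → x ∈ U := fun h => hA h
    simp only [Finset.mem_union, Finset.mem_sdiff]; tauto

lemma card_one {d : Fin n → ℕ} {a b : ℕ} (hN : a ≤ n - 1) {i : Fin n} (hi : d i = b) :
    ((Om d).filter (fun T => cT T i = a)).card
      = (b - 1).choose a * ((NR d).card - (b - 1)).choose (n - 1 - a) := by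
  rw [Finset.card_eq_sum_card_fiberwise (f := fun T => T ∩ Bl d i)
    (t := (Bl d i).powersetCard a)]
  · rw [Finset.sum_const_nat (m := ((NR d).card - (b - 1)).choose (n - 1 - a)),
      Finset.card_powersetCard, card_Bl, hi]
    intro A hA
    rw [Finset.mem_powersetCard] at hA
    have := card_inter_eq (S := NR d) (U := Bl d i) (A := A) (N := n - 1)
      (Finset.filter_subset _ _) hA.1 (by omega)
    rw [card_Bl, hi, hA.2] at this
    rw [← this, Finset.filter_filter]
    congr 1
    refine Finset.filter_congr fun T hT => ?_
    rw [cT_eq_inter hT]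
    constructor
    · exact fun h => h.2
    · intro h; exact ⟨by rw [h, hA.2], h⟩
  · intro T hT
    simp only [Finset.coe_filter, Set.mem_ofPred_eq] at hT
    simp only [Finset.mem_coe, Finset.mem_powersetCard]
    exact ⟨Finset.inter_subset_right, by rw [← cT_eq_inter hT.1, hT.2]⟩

lemma card_two {d : Fin n → ℕ} {a b : ℕ} (hN : 2 * a ≤ n - 1) {i j : Fin n} (hij : i ≠ j)
    (hi : d i = b) (hj : d j = b) :
    ((Om d).filter (fun T => cT T i = a ∧ cT T j = a)).card
      = (b - 1).choose a ^ 2 * ((NR d).card - 2 * (b - 1)).choose (n - 1 - 2 * a) := by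
  have hdis : Disjoint (Bl d i) (Bl d j) := by
    rw [Finset.disjoint_left]
    intro h h1 h2
    simp only [Bl, Finset.mem_filter] at h1 h2
    exact hij (h1.2.symm.trans h2.2)
  rw [Finset.card_eq_sum_card_fiberwise (f := fun T => (T ∩ Bl d i, T ∩ Bl d j))
    (t := (Bl d i).powersetCard a ×ˢ (Bl d j).powersetCard a)]
  · rw [Finset.sum_const_nat (m := ((NR d).card - 2 * (b - 1)).choose (n - 1 - 2 * a)),
      Finset.card_product,
      Finset.card_powersetCard, Finset.card_powersetCard, card_Bl, card_Bl, hi, hj, sq]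
    rintro ⟨A, A'⟩ hA
    rw [Finset.mem_product, Finset.mem_powersetCard, Finset.mem_powersetCard] at hA
    obtain ⟨⟨hA1, hA2⟩, hA3, hA4⟩ := hA
    dsimp only at hA1 hA2 hA3 hA4
    have hAd : Disjoint A A' :=
      Finset.disjoint_of_subset_left hA1 (Finset.disjoint_of_subset_right hA3 hdis)
    have hc : (A ∪ A').card = 2 * a := by
      rw [Finset.card_union_of_disjoint hAd]; omega
    have := card_inter_eq (S := NR d) (U := Bl d i ∪ Bl d j) (A := A ∪ A') (N := n - 1)
      (Finset.union_subset (Finset.filter_subset _ _) (Finset.filter_subset _ _))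
      (Finset.union_subset_union hA1 hA3) (by omega)
    rw [Finset.card_union_of_disjoint hdis, card_Bl, card_Bl, hi, hj, hc, ← two_mul] at this
    rw [← this, Finset.filter_filter]
    congr 1
    refine Finset.filter_congr fun T hT => ?_
    rw [cT_eq_inter hT, cT_eq_inter hT, Prod.mk.injEq]
    constructor
    · rintro ⟨_, h1, h2⟩
      rw [Finset.inter_union_distrib_left, h1, h2]
    · intro h
      have e1 : T ∩ Bl d i = A := by
        have : (T ∩ (Bl d i ∪ Bl d j)) ∩ Bl d i = (A ∪ A') ∩ Bl d i := by rw [h]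
        rw [Finset.inter_assoc, Finset.union_inter_cancel_left,
          Finset.union_inter_distrib_right, Finset.inter_eq_left.2 hA1,
          Finset.disjoint_iff_inter_eq_empty.1
            (Finset.disjoint_of_subset_left hA3 hdis.symm), Finset.union_empty] at this
        exact this
      have e2 : T ∩ Bl d j = A' := by
        have : (T ∩ (Bl d i ∪ Bl d j)) ∩ Bl d j = (A ∪ A') ∩ Bl d j := by rw [h]
        rw [Finset.inter_assoc, Finset.union_inter_cancel_right,
          Finset.union_inter_distrib_right, Finset.inter_eq_left.2 hA3,
          Finset.disjoint_iff_inter_eq_empty.1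
            (Finset.disjoint_of_subset_left hA1 hdis), Finset.empty_union] at this
        exact this
      exact ⟨by rw [e1, e2]; exact ⟨hA2, hA4⟩, e1, e2⟩
  · intro T hT
    simp only [Finset.coe_filter, Set.mem_ofPred_eq] at hT
    simp only [Finset.mem_coe, Finset.mem_product,
      Finset.mem_powersetCard]
    exact ⟨⟨Finset.inter_subset_right, by rw [← cT_eq_inter hT.1, hT.2.1]⟩,
      Finset.inter_subset_right, by rw [← cT_eq_inter hT.1, hT.2.2]⟩

end Fibers

section Prob

/-- Convergence in mean of finitely supported uniform random variables to a constant. -/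
def L1To {α : ℕ → Type*} (Ω : ∀ n, Finset (α n)) (X : ∀ n, α n → ℝ) (c : ℝ) : Prop :=
  Tendsto (fun n => (∑ T ∈ Ω n, |X n T - c|) / ((Ω n).card : ℝ)) atTop (nhds 0)

variable {α : ℕ → Type*} {Ω : ∀ n, Finset (α n)}

lemma L1To.markov {X : ∀ n, α n → ℝ} {c : ℝ} (h : L1To Ω X c) (ε : ℝ) (hε : 0 < ε) :
    Tendsto (fun n => (((Ω n).filter (fun T => ε < |X n T - c|)).card : ℝ) / ((Ω n).card : ℝ))
      atTop (nhds 0) := by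
  have h2 := h.const_mul ε⁻¹
  rw [mul_zero] at h2
  refine squeeze_zero (fun n => by positivity) (fun n => ?_) h2
  rw [← mul_div_assoc]
  refine div_le_div_of_nonneg_right ?_ (by positivity)
  rw [← div_eq_inv_mul, le_div_iff₀ hε]
  calc (((Ω n).filter (fun T => ε < |X n T - c|)).card : ℝ) * ε
      = ∑ T ∈ (Ω n).filter (fun T => ε < |X n T - c|), ε := by simp
    _ ≤ ∑ T ∈ (Ω n).filter (fun T => ε < |X n T - c|), |X n T - c| :=
        Finset.sum_le_sum fun T hT => (Finset.mem_filter.1 hT).2.le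
    _ ≤ _ := Finset.sum_le_sum_of_subset_of_nonneg (Finset.filter_subset _ _)
        fun _ _ _ => abs_nonneg _

lemma L1To.of_sq {X : ∀ n, α n → ℝ} {c : ℝ}
    (h : Tendsto (fun n => (∑ T ∈ Ω n, (X n T - c) ^ 2) / ((Ω n).card : ℝ)) atTop (nhds 0)) :
    L1To Ω X c := by
  have h2 := (Real.continuous_sqrt.tendsto 0).comp h
  rw [Real.sqrt_zero] at h2
  refine squeeze_zero (fun n => by positivity) (fun n => ?_) h2
  apply Real.le_sqrt_of_sq_le
  rcases Nat.eq_zero_or_pos (Ω n).card with h0 | h0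
  · simp [h0]
  have hM : (0 : ℝ) < (Ω n).card := by exact_mod_cast h0
  have := sq_sum_le_card_mul_sum_sq (s := Ω n) (f := fun T => |X n T - c|)
  simp only [sq_abs] at this
  rw [div_pow, div_le_div_iff₀ (by positivity) hM]
  nlinarith

lemma L1To.congr' {X Y : ∀ n, α n → ℝ} {c : ℝ} (h : L1To Ω X c)
    (hXY : ∀ n, ∀ T ∈ Ω n, X n T = Y n T) : L1To Ω Y c := by
  refine Tendsto.congr (fun n => ?_) h
  congr 1
  exact Finset.sum_congr rfl fun T hT => by rw [hXY n T hT]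

lemma L1To.sum {ι : Type*} (s : Finset ι) (w : ι → ℝ) {Y : ι → ∀ n, α n → ℝ} {y : ι → ℝ}
    (h : ∀ k ∈ s, L1To Ω (Y k) (y k)) :
    L1To Ω (fun n T => ∑ k ∈ s, w k * Y k n T) (∑ k ∈ s, w k * y k) := by
  have h2 : Tendsto (fun n => ∑ k ∈ s, |w k| * ((∑ T ∈ Ω n, |Y k n T - y k|) / ((Ω n).card : ℝ)))
      atTop (nhds (∑ k ∈ s, |w k| * 0)) :=
    tendsto_finsetSum _ fun k hk => (h k hk).const_mul _
  simp only [mul_zero, Finset.sum_const_zero] at h2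
  refine squeeze_zero (fun n => by positivity) (fun n => ?_) h2
  have : ∑ k ∈ s, |w k| * ((∑ T ∈ Ω n, |Y k n T - y k|) / ((Ω n).card : ℝ))
      = (∑ T ∈ Ω n, ∑ k ∈ s, |w k| * |Y k n T - y k|) / ((Ω n).card : ℝ) := by
    rw [Finset.sum_comm, Finset.sum_div]
    refine Finset.sum_congr rfl fun k _ => ?_
    rw [← Finset.mul_sum, mul_div_assoc]
  rw [this]
  refine div_le_div_of_nonneg_right (Finset.sum_le_sum fun T _ => ?_) (by positivity)
  rw [← Finset.sum_sub_distrib]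
  refine (Finset.abs_sum_le_sum_abs _ _).trans (Finset.sum_le_sum fun k _ => ?_)
  rw [← mul_sub, abs_mul]

lemma trunc {X : ∀ n, α n → ℝ} {Y : ℕ → ∀ n, α n → ℝ} {y : ℕ → ℝ} {S : ℕ → ℝ} {w : ℕ → ℕ → ℝ}
    {p : ℕ → ℝ} {μ2 : ℝ}
    (hμ2 : HasSum (fun k : ℕ => (k : ℝ) ^ 2 * p k) μ2)
    (hS : Tendsto S atTop (nhds μ2))
    (hw : ∀ b, Tendsto (fun n => w n b) atTop (nhds (p b)))
    (hy : ∀ b : ℕ, |y b| ≤ (b : ℝ) ^ 2 * p b)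
    (hX : ∀ B n, ∀ T ∈ Ω n, |X n T - ∑ b ∈ Finset.range B, Y b n T|
      ≤ S n - ∑ b ∈ Finset.range B, (b : ℝ) ^ 2 * w n b)
    (hY : ∀ b, L1To Ω (Y b) (y b)) :
    L1To Ω X (∑' b, y b) := by
  have hys : HasSum y (∑' b, y b) :=
    (Summable.of_norm_bounded hμ2.summable (fun b => by simpa using hy b)).hasSum
  set L := ∑' b, y b with hL
  have tail : ∀ B, |∑ b ∈ Finset.range B, y b - L|
      ≤ μ2 - ∑ b ∈ Finset.range B, (b : ℝ) ^ 2 * p b := by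
    intro B
    have h1 := sum_le_hasSum (Finset.range B)
      (fun b _ => by have := (abs_le.1 (hy b)).2; linarith) (hμ2.sub hys)
    have h2 := sum_le_hasSum (Finset.range B)
      (fun b _ => by have := (abs_le.1 (hy b)).1; linarith) (hμ2.add hys)
    rw [Finset.sum_sub_distrib] at h1
    rw [Finset.sum_add_distrib] at h2
    rw [abs_le]
    constructor <;> linarith
  have hbound : ∀ B n, (∑ T ∈ Ω n, |X n T - L|) / ((Ω n).card : ℝ)
      ≤ |S n - ∑ b ∈ Finset.range B, (b : ℝ) ^ 2 * w n b|
        + (∑ T ∈ Ω n, |∑ b ∈ Finset.range B, 1 * Y b n T - ∑ b ∈ Finset.range B, 1 * y b|)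
            / ((Ω n).card : ℝ)
        + (μ2 - ∑ b ∈ Finset.range B, (b : ℝ) ^ 2 * p b) := by
    intro B n
    have ht := tail B
    rcases Nat.eq_zero_or_pos (Ω n).card with h0 | h0
    · simp only [h0, Nat.cast_zero, div_zero]
      have := (abs_nonneg _).trans ht
      positivity
    have hM : (0 : ℝ) < (Ω n).card := by exact_mod_cast h0
    rw [div_le_iff₀ hM, add_mul, add_mul, div_mul_cancel₀ _ hM.ne']
    calc ∑ T ∈ Ω n, |X n T - L|
        ≤ ∑ T ∈ Ω n, (|S n - ∑ b ∈ Finset.range B, (b : ℝ) ^ 2 * w n b|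
          + |∑ b ∈ Finset.range B, 1 * Y b n T - ∑ b ∈ Finset.range B, 1 * y b|
          + (μ2 - ∑ b ∈ Finset.range B, (b : ℝ) ^ 2 * p b)) := by
          refine Finset.sum_le_sum fun T hT => ?_
          have h1 := (hX B n T hT).trans (le_abs_self _)
          simp only [one_mul]
          have e : X n T - L = (X n T - ∑ b ∈ Finset.range B, Y b n T)
            + (∑ b ∈ Finset.range B, Y b n T - ∑ b ∈ Finset.range B, y b)
            + (∑ b ∈ Finset.range B, y b - L) := by ring
          rw [e]
          refine (abs_add_three _ _ _).trans ?_
          linarith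
      _ = _ := by
          rw [Finset.sum_add_distrib, Finset.sum_add_distrib]
          simp only [Finset.sum_const, nsmul_eq_mul]
          ring
  unfold L1To
  rw [Metric.tendsto_atTop']
  intro ε hε
  have hpt : Tendsto (fun B => μ2 - ∑ b ∈ Finset.range B, (b : ℝ) ^ 2 * p b) atTop (nhds 0) := by
    have := hμ2.tendsto_sum_nat.const_sub μ2
    simpa using this
  obtain ⟨B, hB⟩ := (hpt.eventually (gt_mem_nhds (show (0 : ℝ) < ε / 2 by linarith))).exists
  have hlim : Tendsto (fun n => |S n - ∑ b ∈ Finset.range B, (b : ℝ) ^ 2 * w n b|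
        + (∑ T ∈ Ω n, |∑ b ∈ Finset.range B, 1 * Y b n T - ∑ b ∈ Finset.range B, 1 * y b|)
            / ((Ω n).card : ℝ)
        + (μ2 - ∑ b ∈ Finset.range B, (b : ℝ) ^ 2 * p b)) atTop
      (nhds (|μ2 - ∑ b ∈ Finset.range B, (b : ℝ) ^ 2 * p b| + 0
        + (μ2 - ∑ b ∈ Finset.range B, (b : ℝ) ^ 2 * p b))) := by
    refine Tendsto.add (Tendsto.add ?_ ?_) tendsto_const_nhds
    · exact (hS.sub (tendsto_finsetSum _ fun b _ => (hw b).const_mul _)).abs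
    · exact L1To.sum (Finset.range B) (fun _ => 1) (fun b _ => hY b)
  have h0 := (abs_nonneg _).trans (tail B)
  rw [abs_of_nonneg h0] at hlim
  have := hlim.eventually (gt_mem_nhds (show _ < ε by linarith))
  obtain ⟨n0, hn0⟩ := eventually_atTop.1 this
  refine ⟨n0, fun n hn => ?_⟩
  rw [Real.dist_eq, sub_zero, abs_of_nonneg (by positivity)]
  exact (hbound B n).trans_lt (hn0 n hn.le)

end Prob

section Limits

lemma desc_lim {x m : ℕ → ℕ} {c : ℝ} (hm : Tendsto m atTop atTop)
    (h : Tendsto (fun n => (x n : ℝ) / m n) atTop (nhds c)) (s : ℕ) :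
    Tendsto (fun n => ((x n).descFactorial s : ℝ) / (m n : ℝ) ^ s) atTop (nhds (c ^ s)) := by
  have hm' : Tendsto (fun n => (m n : ℝ)) atTop atTop := tendsto_natCast_atTop_atTop.comp hm
  induction s with
  | zero => simp
  | succ s ih =>
    have h1 : Tendsto (fun n => ((x n - s : ℕ) : ℝ) / m n) atTop (nhds c) := by
      have h2 : Tendsto (fun n => (x n : ℝ) / m n - (s : ℝ) / m n) atTop (nhds c) := by
        simpa using h.sub (hm'.const_div_atTop (s : ℝ))
      refine tendsto_of_tendsto_of_tendsto_of_le_of_le h2 h (fun n => ?_) (fun n => ?_)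
      · dsimp only
        rw [← sub_div]
        refine div_le_div_of_nonneg_right ?_ (by positivity)
        rw [sub_le_iff_le_add]
        exact_mod_cast (by omega : x n ≤ (x n - s) + s)
      · refine div_le_div_of_nonneg_right ?_ (by positivity)
        exact Nat.cast_le.2 (Nat.sub_le _ _)
    have h2 := h1.mul ih
    rw [pow_succ']
    refine h2.congr fun n => ?_
    rw [Nat.descFactorial_succ, pow_succ', div_mul_div_comm]
    push_cast
    rfl

lemma choose_id1 {m N s : ℕ} (hs : s ≤ N) (hN : N ≤ m) :
    (m - s).choose (N - s) * m.descFactorial s = m.choose N * N.descFactorial s := by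
  have := Nat.choose_mul (n := m) hs
  rw [Nat.descFactorial_eq_factorial_mul_choose, Nat.descFactorial_eq_factorial_mul_choose]
  calc (m - s).choose (N - s) * (s.factorial * m.choose s)
      = s.factorial * (m.choose s * (m - s).choose (N - s)) := by ring
    _ = s.factorial * (m.choose N * N.choose s) := by rw [this]
    _ = _ := by ring

lemma choose_id2 {m N t : ℕ} (hN : N ≤ m) (ht : t ≤ m) :
    (m - t).choose N * m.descFactorial t = m.choose N * (m - N).descFactorial t := by
  by_cases h : t ≤ m - N
  · have := choose_id1 (m := m) (N := m - N) h (by omega)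
    rw [Nat.choose_symm hN] at this
    rw [← this]
    congr 1
    rw [show m - N - t = (m - t) - N by omega]
    exact (Nat.choose_symm (by omega)).symm
  · rw [Nat.choose_eq_zero_of_lt (by omega), Nat.descFactorial_of_lt (show m - N < t by omega)]
    simp

lemma choose_id {m N s t : ℕ} (hs : s ≤ N) (hN : N ≤ m) (ht : s + t ≤ m) :
    (m - (s + t)).choose (N - s) * m.descFactorial (s + t)
      = m.choose N * (N.descFactorial s * (m - N).descFactorial t) := by
  have h1 := choose_id1 hs hN
  have h2 := choose_id2 (m := m - s) (N := N - s) (t := t) (by omega) (by omega)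
  have h3 := Nat.descFactorial_mul_descFactorial (n := m) (k := s) (m := s + t) (by omega)
  rw [Nat.add_sub_cancel_left] at h3
  rw [← h3, ← Nat.sub_sub, ← mul_assoc, h2, mul_right_comm, h1,
    show m - s - (N - s) = m - N by omega]
  ring

lemma choose_lim {m N : ℕ → ℕ} {ρ : ℝ} (hm : Tendsto m atTop atTop) (hN : Tendsto N atTop atTop)
    (hNm : ∀ n, N n ≤ m n) (hρ : Tendsto (fun n => (N n : ℝ) / m n) atTop (nhds ρ))
    (r s : ℕ) (hsr : s ≤ r) :
    Tendsto (fun n => ((m n - r).choose (N n - s) : ℝ) / ((m n).choose (N n) : ℝ)) atTop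
      (nhds (ρ ^ s * (1 - ρ) ^ (r - s))) := by
  obtain ⟨t, rfl⟩ := Nat.exists_eq_add_of_le hsr
  rw [Nat.add_sub_cancel_left]
  have hev : ∀ᶠ n in atTop, 0 < m n := hm.eventually (eventually_gt_atTop 0)
  have h1 : Tendsto (fun n => (m n : ℝ) / m n) atTop (nhds 1) := by
    refine Tendsto.congr' ?_ tendsto_const_nhds
    filter_upwards [hev] with n hn
    have : (m n : ℝ) ≠ 0 := by exact_mod_cast hn.ne'
    field_simp
  have hρ' : Tendsto (fun n => ((m n - N n : ℕ) : ℝ) / m n) atTop (nhds (1 - ρ)) := by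
    refine (h1.sub hρ).congr fun n => ?_
    rw [Nat.cast_sub (hNm n), sub_div]
  have A := ((desc_lim hm hρ s).mul (desc_lim hm hρ' t)).div (desc_lim hm h1 (s + t)) (by simp)
  rw [one_pow, div_one] at A
  refine A.congr' ?_
  filter_upwards [hev, hm.eventually (eventually_ge_atTop (s + t)),
    hN.eventually (eventually_ge_atTop s)] with n h0 h1 h2
  have hid := choose_id h2 (hNm n) h1
  have hM : ((m n).choose (N n) : ℝ) ≠ 0 := by
    exact_mod_cast (Nat.choose_pos (hNm n)).ne'
  have hD : ((m n).descFactorial (s + t) : ℝ) ≠ 0 := by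
    exact_mod_cast (Nat.descFactorial_pos.2 h1).ne'
  have hm0 : (m n : ℝ) ≠ 0 := by exact_mod_cast h0.ne'
  have hid' : ((m n - (s + t)).choose (N n - s) : ℝ) * ((m n).descFactorial (s + t) : ℝ)
      = ((m n).choose (N n) : ℝ) *
        (((N n).descFactorial s : ℝ) * ((m n - N n).descFactorial t : ℝ)) := by
    exact_mod_cast hid
  simp only [Pi.div_apply]
  rw [div_mul_div_comm, ← pow_add, div_div_div_cancel_right₀ (pow_ne_zero _ hm0),
    div_eq_div_iff hD hM]
  linarith

end Limits

section Main

lemma split_bound {n : ℕ} (d : Fin n → ℕ) (g : Fin n → ℝ) (hg : ∀ i, |g i| ≤ (d i : ℝ) ^ 2)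
    (B : ℕ) :
    |(∑ i, g i) / n - ∑ b ∈ Finset.range B, (∑ i with d i = b, g i) / (n : ℝ)|
      ≤ (∑ i, (d i : ℝ) ^ 2) / n
        - ∑ b ∈ Finset.range B, (b : ℝ) ^ 2 * ((Nat.card {i : Fin n // d i = b} : ℝ) / n) := by
  have key : ∀ h : Fin n → ℝ, ∑ b ∈ Finset.range B, (∑ i with d i = b, h i) / (n : ℝ)
      = (∑ i with d i < B, h i) / n := by
    intro h
    rw [← Finset.sum_div]
    congr 1
    rw [← Finset.sum_fiberwise_of_maps_to (s := Finset.univ.filter (fun i => d i < B))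
      (t := Finset.range B) (g := d) (fun i hi => by simpa using hi)]
    refine Finset.sum_congr rfl fun b hb => ?_
    rw [Finset.filter_filter]
    refine Finset.sum_congr (Finset.filter_congr fun i _ => ?_) fun _ _ => rfl
    have := Finset.mem_range.1 hb
    constructor
    · intro h; exact ⟨by omega, h⟩
    · exact fun h => h.2
  have key2 : ∀ b ∈ Finset.range B, (b : ℝ) ^ 2 * ((Nat.card {i : Fin n // d i = b} : ℝ) / n)
      = (∑ i with d i = b, (d i : ℝ) ^ 2) / (n : ℝ) := by
    intro b _
    rw [Nat.card_eq_fintype_card, Fintype.card_subtype, ← mul_div_assoc]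
    congr 1
    rw [Finset.sum_congr rfl (g := fun _ => (b : ℝ) ^ 2)
      (fun i hi => by rw [(Finset.mem_filter.1 hi).2])]
    simp [mul_comm]
  rw [Finset.sum_congr rfl key2, key, key, ← sub_div, ← sub_div,
    ← Finset.sum_filter_add_sum_filter_not Finset.univ (fun i => d i < B) g,
    ← Finset.sum_filter_add_sum_filter_not Finset.univ (fun i => d i < B)
      (fun i => (d i : ℝ) ^ 2), add_sub_cancel_left, add_sub_cancel_left, abs_div, Nat.abs_cast]
  refine div_le_div_of_nonneg_right ?_ (by positivity)
  exact (Finset.abs_sum_le_sum_abs _ _).trans (Finset.sum_le_sum fun i _ => hg i)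

variable {dseq : (n : ℕ) → Fin n → ℕ} {p : ℕ → ℝ} {μ2 : ℝ}

lemma mean_lim
    (hd : ∀ n i, 1 ≤ dseq n i) (hpnn : ∀ k, 0 ≤ p k)
    (hμ2 : HasSum (fun k : ℕ => (k : ℝ) ^ 2 * p k) μ2)
    (hpconv : ∀ k : ℕ, Tendsto
      (fun n => (Nat.card {i : Fin n // dseq n i = k} : ℝ) / n) atTop (nhds (p k)))
    (hμ2conv : Tendsto (fun n => (∑ i, (dseq n i : ℝ) ^ 2) / n) atTop (nhds μ2)) :
    Tendsto (fun n => (∑ i, (dseq n i : ℝ)) / n) atTop (nhds (mu1 p)) := by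
  have hle : ∀ k : ℕ, (k : ℝ) ≤ (k : ℝ) ^ 2 := by
    intro k
    exact_mod_cast Nat.le_self_pow two_ne_zero k
  have := trunc (α := fun _ => Unit) (Ω := fun _ => {()})
    (X := fun n _ => (∑ i, (dseq n i : ℝ)) / n)
    (Y := fun b n _ => (∑ i with dseq n i = b, (dseq n i : ℝ)) / n)
    (y := fun b => (b : ℝ) * p b) (S := fun n => (∑ i, (dseq n i : ℝ) ^ 2) / n)
    (w := fun n b => (Nat.card {i : Fin n // dseq n i = b} : ℝ) / n) hμ2 hμ2conv hpconv
    (fun b => by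
      rw [abs_of_nonneg (mul_nonneg (by positivity) (hpnn b))]
      exact mul_le_mul_of_nonneg_right (hle b) (hpnn b))
    (fun B n T _ => split_bound (dseq n) (fun i => (dseq n i : ℝ))
      (fun i => by rw [Nat.abs_cast]; exact hle _) B)
    (fun b => by
      unfold L1To
      have h := (hpconv b).const_mul (b : ℝ)
      have h2 := (h.sub_const ((b : ℝ) * p b)).abs
      rw [sub_self, abs_zero] at h2
      refine h2.congr fun n => ?_
      rw [Finset.sum_singleton, Finset.card_singleton, Nat.cast_one, div_one]
      rw [Nat.card_eq_fintype_card, Fintype.card_subtype, ← mul_div_assoc]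
      congr 3
      rw [Finset.sum_congr rfl (g := fun _ => (b : ℝ))
        (fun i hi => by rw [(Finset.mem_filter.1 hi).2])]
      simp [mul_comm])
  unfold L1To at this
  simp only [Finset.sum_singleton, Finset.card_singleton, Nat.cast_one, div_one] at this
  rw [tendsto_iff_norm_sub_tendsto_zero]
  exact this

lemma NR_ge (hd : ∀ n i, 1 ≤ dseq n i) (hge : ∀ n, 2 * n ≤ ∑ i, dseq n i) (n : ℕ) :
    (NR (dseq n)).card + n = ∑ i, dseq n i ∧ n ≤ (NR (dseq n)).card := by
  have h : (NR (dseq n)).card + n = ∑ i, dseq n i := by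
    rw [card_NR]
    have h1 : ∑ i : Fin n, 1 = n := by simp
    have h2 : ∑ i, (dseq n i - 1) + ∑ i : Fin n, 1 = ∑ i, dseq n i := by
      rw [← Finset.sum_add_distrib]
      refine Finset.sum_congr rfl fun i _ => ?_
      have := hd n i
      omega
    rwa [h1] at h2
  have := hge n
  exact ⟨h, by omega⟩

lemma mu1_ge (hd : ∀ n i, 1 ≤ dseq n i) (hge : ∀ n, 2 * n ≤ ∑ i, dseq n i)
    (hm : Tendsto (fun n => (∑ i, (dseq n i : ℝ)) / n) atTop (nhds (mu1 p))) :
    2 ≤ mu1 p := by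
  refine ge_of_tendsto hm ?_
  filter_upwards [eventually_gt_atTop 0] with n hn
  have : (0 : ℝ) < n := by exact_mod_cast hn
  rw [le_div_iff₀ this]
  exact_mod_cast hge n

lemma rho_lim (hd : ∀ n i, 1 ≤ dseq n i) (hge : ∀ n, 2 * n ≤ ∑ i, dseq n i)
    (hm : Tendsto (fun n => (∑ i, (dseq n i : ℝ)) / n) atTop (nhds (mu1 p))) :
    Tendsto (fun n => ((n - 1 : ℕ) : ℝ) / ((NR (dseq n)).card : ℝ)) atTop (nhds (rho p)) := by
  have h2 := mu1_ge hd hge hm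
  have h1 : Tendsto (fun n : ℕ => 1 - 1 / (n : ℝ)) atTop (nhds 1) := by
    simpa using (tendsto_one_div_atTop_nhds_zero_nat (𝕜 := ℝ)).const_sub 1
  have h3 := h1.div (hm.sub_const 1) (by linarith : (0 : ℝ) < mu1 p - 1).ne'
  refine h3.congr' ?_
  filter_upwards [eventually_gt_atTop 0] with n hn
  have hn' : (0 : ℝ) < n := by exact_mod_cast hn
  obtain ⟨e, hle⟩ := NR_ge hd hge n
  have e' : (∑ i, (dseq n i : ℝ)) = (NR (dseq n)).card + n := by exact_mod_cast e.symm
  have hp : (0 : ℝ) < (NR (dseq n)).card := by exact_mod_cast lt_of_lt_of_le hn hle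
  rw [Pi.div_apply, e', Nat.cast_sub hn]
  have e2 : ((NR (dseq n)).card + (n : ℝ)) / n - 1 = (NR (dseq n)).card / (n : ℝ) := by
    field_simp
    ring
  rw [e2]
  push_cast
  field_simp

lemma binomP_nonneg {ρ : ℝ} (h0 : 0 ≤ ρ) (h1 : ρ ≤ 1) (m a : ℕ) : 0 ≤ binomP ρ m a := by
  unfold binomP
  have : 0 ≤ 1 - ρ := by linarith
  positivity

lemma binomP_sum (ρ : ℝ) {b : ℕ} (hb : 1 ≤ b) :
    ∑ a ∈ Finset.range b, binomP ρ (b - 1) a = 1 := by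
  have := add_pow ρ (1 - ρ) (b - 1)
  rw [add_sub_cancel, one_pow, Nat.sub_add_cancel hb] at this
  rw [this]
  refine Finset.sum_congr rfl fun a _ => ?_
  unfold binomP
  ring

lemma moments {n : ℕ} {d : Fin n → ℕ} {a b : ℕ} (hN : 2 * a ≤ n - 1)
    (hM : n - 1 ≤ (NR d).card) (c : ℝ) (hn : 0 < n) :
    (∑ T ∈ Om d, ((Nat.card {i : Fin n // d i = b ∧ cT T i = a} : ℝ) / n - c) ^ 2)
        / ((Om d).card : ℝ)
      = ((Nat.card {i : Fin n // d i = b} : ℝ) / n) *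
          (((b - 1).choose a : ℝ) * ((((NR d).card - (b - 1)).choose (n - 1 - a) : ℝ)
            / ((NR d).card.choose (n - 1) : ℝ))) * (1 / n)
        + (((Nat.card {i : Fin n // d i = b} : ℝ) / n) ^ 2
          - ((Nat.card {i : Fin n // d i = b} : ℝ) / n) * (1 / n)) *
          (((b - 1).choose a : ℝ) ^ 2 *
            ((((NR d).card - 2 * (b - 1)).choose (n - 1 - 2 * a) : ℝ)
            / ((NR d).card.choose (n - 1) : ℝ)))
        - 2 * c * (((Nat.card {i : Fin n // d i = b} : ℝ) / n) *
          (((b - 1).choose a : ℝ) * ((((NR d).card - (b - 1)).choose (n - 1 - a) : ℝ)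
            / ((NR d).card.choose (n - 1) : ℝ))))
        + c ^ 2 := by
  have hcard : (Om d).card = (NR d).card.choose (n - 1) := by
    rw [Om, Finset.card_powersetCard]
  have hMpos : (0 : ℝ) < ((NR d).card.choose (n - 1) : ℝ) := by
    exact_mod_cast Nat.choose_pos hM
  have hn' : (0 : ℝ) < n := by exact_mod_cast hn
  set I := Finset.univ.filter (fun i => d i = b) with hI
  have hIc : Nat.card {i : Fin n // d i = b} = I.card := by
    rw [Nat.card_eq_fintype_card, Fintype.card_subtype]
  have hX : ∀ T : Finset (HE d), (Nat.card {i : Fin n // d i = b ∧ cT T i = a} : ℝ)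
      = ∑ i ∈ I, if cT T i = a then (1 : ℝ) else 0 := by
    intro T
    rw [Nat.card_eq_fintype_card, Fintype.card_subtype, Finset.sum_boole, hI,
      Finset.filter_filter]
  have h1 : ∑ T ∈ Om d, (∑ i ∈ I, if cT T i = a then (1 : ℝ) else 0)
      = (I.card : ℝ) * (((b - 1).choose a * ((NR d).card - (b - 1)).choose (n - 1 - a) : ℕ) : ℝ)
      := by
    rw [Finset.sum_comm, ← nsmul_eq_mul, ← Finset.sum_const]
    refine Finset.sum_congr rfl fun i hi => ?_
    rw [Finset.sum_boole, card_one (by omega) (Finset.mem_filter.1 hi).2]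
  have h2 : ∑ T ∈ Om d, (∑ i ∈ I, if cT T i = a then (1 : ℝ) else 0) ^ 2
      = (I.card : ℝ) * (((b - 1).choose a * ((NR d).card - (b - 1)).choose (n - 1 - a) : ℕ) : ℝ)
      + ((I.card : ℝ) ^ 2 - I.card) * (((b - 1).choose a ^ 2 *
          ((NR d).card - 2 * (b - 1)).choose (n - 1 - 2 * a) : ℕ) : ℝ) := by
    set C1 : ℝ := (((b - 1).choose a * ((NR d).card - (b - 1)).choose (n - 1 - a) : ℕ) : ℝ)
    set C2 : ℝ := (((b - 1).choose a ^ 2 *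
          ((NR d).card - 2 * (b - 1)).choose (n - 1 - 2 * a) : ℕ) : ℝ)
    have e : ∀ i ∈ I, ∀ j ∈ I, ∑ T ∈ Om d, ((if cT T i = a then (1 : ℝ) else 0)
        * (if cT T j = a then (1 : ℝ) else 0)) = C2 + if i = j then (C1 - C2) else 0 := by
      intro i hi j hj
      have hi := (Finset.mem_filter.1 hi).2
      have hj := (Finset.mem_filter.1 hj).2
      have : ∀ T : Finset (HE d), ((if cT T i = a then (1 : ℝ) else 0)
        * (if cT T j = a then (1 : ℝ) else 0)) = if cT T i = a ∧ cT T j = a then 1 else 0 := by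
        intro T
        by_cases h1 : cT T i = a <;> by_cases h2 : cT T j = a <;> simp [h1, h2]
      simp only [this]
      rw [Finset.sum_boole]
      by_cases hij : i = j
      · subst hij
        simp only [and_self, if_true]
        rw [card_one (by omega) hi]
        simp [C1]
      · rw [card_two hN hij hi hj]
        simp [hij, C2]
    simp only [sq, Finset.sum_mul_sum]
    rw [Finset.sum_comm]
    have e2 : ∀ i ∈ I, ∑ T ∈ Om d, ∑ j ∈ I, ((if cT T i = a then (1 : ℝ) else 0)
        * (if cT T j = a then (1 : ℝ) else 0)) = I.card * C2 + (C1 - C2) := by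
      intro i hi
      rw [Finset.sum_comm, Finset.sum_congr rfl (e i hi), Finset.sum_add_distrib,
        Finset.sum_ite_eq, if_pos hi]
      simp
    rw [Finset.sum_congr rfl e2, Finset.sum_const, nsmul_eq_mul]
    ring
  have h3 : ∑ T ∈ Om d, ((Nat.card {i : Fin n // d i = b ∧ cT T i = a} : ℝ) / n - c) ^ 2
      = (∑ T ∈ Om d, (∑ i ∈ I, if cT T i = a then (1 : ℝ) else 0) ^ 2) / n ^ 2
        - 2 * c * (∑ T ∈ Om d, (∑ i ∈ I, if cT T i = a then (1 : ℝ) else 0)) / n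
        + c ^ 2 * ((NR d).card.choose (n - 1) : ℝ) := by
    rw [← hcard, Finset.mul_sum, Finset.sum_div, Finset.sum_div, ← Finset.sum_sub_distrib,
      mul_comm (c ^ 2), ← nsmul_eq_mul, ← Finset.sum_const, ← Finset.sum_add_distrib]
    refine Finset.sum_congr rfl fun T _ => ?_
    rw [hX T]
    field_simp
    ring
  rw [h3, h1, h2, hIc, hcard]
  push_cast
  field_simp

lemma pab_lim
    (hd : ∀ n i, 1 ≤ dseq n i) (hge : ∀ n, 2 * n ≤ ∑ i, dseq n i)
    (hm : Tendsto (fun n => (∑ i, (dseq n i : ℝ)) / n) atTop (nhds (mu1 p)))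
    (hpconv : ∀ k : ℕ, Tendsto
      (fun n => (Nat.card {i : Fin n // dseq n i = k} : ℝ) / n) atTop (nhds (p k)))
    (a b : ℕ) (hab : a < b) :
    L1To (fun n => Om (dseq n))
      (fun n T => (Nat.card {i : Fin n // dseq n i = b ∧ cT T i = a} : ℝ) / n)
      (p b * binomP (rho p) (b - 1) a) := by
  set c := p b * binomP (rho p) (b - 1) a with hc
  refine L1To.of_sq ?_
  have hNR := NR_ge hd hge
  have hmt : Tendsto (fun n => (NR (dseq n)).card) atTop atTop :=
    tendsto_atTop_mono (fun n => (hNR n).2) tendsto_id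
  have hNt : Tendsto (fun n : ℕ => n - 1) atTop atTop := tendsto_sub_atTop_nat 1
  have hle : ∀ n, n - 1 ≤ (NR (dseq n)).card := fun n => by have := (hNR n).2; omega
  have L1 := (choose_lim hmt hNt hle (rho_lim hd hge hm) (b - 1) a (by omega)).const_mul
    ((b - 1).choose a : ℝ)
  have L2 := (choose_lim hmt hNt hle (rho_lim hd hge hm) (2 * (b - 1)) (2 * a)
    (by omega)).const_mul (((b - 1).choose a : ℝ) ^ 2)
  have hw := hpconv b
  have hz := tendsto_one_div_atTop_nhds_zero_nat (𝕜 := ℝ)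
  have main := ((((hw.mul L1).mul hz).add (((hw.pow 2).sub (hw.mul hz)).mul L2)).sub
    ((hw.mul L1).const_mul (2 * c))).add_const (c ^ 2)
  have hzero : (p b * (((b - 1).choose a : ℝ) * (rho p ^ a * (1 - rho p) ^ (b - 1 - a))) * 0
      + (p b ^ 2 - p b * 0) * (((b - 1).choose a : ℝ) ^ 2 *
        (rho p ^ (2 * a) * (1 - rho p) ^ (2 * (b - 1) - 2 * a)))
      - 2 * c * (p b * (((b - 1).choose a : ℝ) * (rho p ^ a * (1 - rho p) ^ (b - 1 - a))))
      + c ^ 2) = 0 := by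
    rw [hc, binomP, ← Nat.mul_sub, pow_mul', pow_mul']
    ring
  rw [hzero] at main
  refine main.congr' ?_
  filter_upwards [eventually_ge_atTop (2 * a + 1)] with n hn
  exact (moments (by omega) (hle n) c (by omega)).symm

lemma f_lim
    (hd : ∀ n i, 1 ≤ dseq n i)
    (hpnn : ∀ k, 0 ≤ p k)
    (hμ2 : HasSum (fun k : ℕ => (k : ℝ) ^ 2 * p k) μ2)
    (hpconv : ∀ k : ℕ, Tendsto
      (fun n => (Nat.card {i : Fin n // dseq n i = k} : ℝ) / n) atTop (nhds (p k)))
    (hμ2conv : Tendsto (fun n => (∑ i, (dseq n i : ℝ) ^ 2) / n) atTop (nhds μ2))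
    (hP : ∀ a b, a < b → L1To (fun n => Om (dseq n))
      (fun n T => (Nat.card {i : Fin n // dseq n i = b ∧ cT T i = a} : ℝ) / n)
      (p b * binomP (rho p) (b - 1) a))
    (f : ℕ → ℝ)
    (hf : ∀ a b : ℕ, a < b → |f a| ≤ (b : ℝ) ^ 2)
    (hy : ∀ b : ℕ, |∑ a ∈ Finset.range b, f a * (p b * binomP (rho p) (b - 1) a)|
      ≤ (b : ℝ) ^ 2 * p b) :
    L1To (fun n => Om (dseq n)) (fun n T => (∑ i, f (cT T i)) / n)
      (∑' b : ℕ, ∑ a ∈ Finset.range b, f a * (p b * binomP (rho p) (b - 1) a)) := by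
  have hlt : ∀ n, ∀ T ∈ Om (dseq n), ∀ i, cT T i < dseq n i := by
    intro n T hT i
    have := cT_le hT i
    have := hd n i
    omega
  refine trunc (Y := fun b n T => (∑ i with dseq n i = b, f (cT T i)) / n) hμ2 hμ2conv hpconv hy
    ?_ ?_
  · intro B n T hT
    exact split_bound (dseq n) (fun i => f (cT T i)) (fun i => hf _ _ (hlt n T hT i)) B
  · intro b
    refine (L1To.sum (Finset.range b) f (fun a ha => hP a b (Finset.mem_range.1 ha))).congr' ?_
    intro n T hT
    simp only [← mul_div_assoc]
    rw [← Finset.sum_div]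
    congr 1
    rw [← Finset.sum_fiberwise_of_maps_to (s := Finset.univ.filter (fun i => dseq n i = b))
      (t := Finset.range b) (g := fun i => cT T i)
      (fun i hi => by
        have := hlt n T hT i
        rw [(Finset.mem_filter.1 hi).2] at this
        exact Finset.mem_range.2 this)]
    refine Finset.sum_congr rfl fun a _ => ?_
    rw [Finset.filter_filter, Nat.card_eq_fintype_card, Fintype.card_subtype,
      Finset.sum_congr rfl (g := fun _ => f a)
      (fun i hi => by rw [(Finset.mem_filter.1 hi).2.2])]
    simp [mul_comm]

lemma y_bound (hpnn : ∀ k, 0 ≤ p k) (h0 : 0 ≤ rho p) (h1 : rho p ≤ 1) (f : ℕ → ℝ)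
    (hf : ∀ a b : ℕ, a < b → |f a| ≤ (b : ℝ) ^ 2) (b : ℕ) :
    |∑ a ∈ Finset.range b, f a * (p b * binomP (rho p) (b - 1) a)| ≤ (b : ℝ) ^ 2 * p b := by
  rcases Nat.eq_zero_or_pos b with rfl | hb
  · simp
  calc |∑ a ∈ Finset.range b, f a * (p b * binomP (rho p) (b - 1) a)|
      ≤ ∑ a ∈ Finset.range b, |f a * (p b * binomP (rho p) (b - 1) a)| :=
        Finset.abs_sum_le_sum_abs _ _
    _ ≤ ∑ a ∈ Finset.range b, (b : ℝ) ^ 2 * p b * binomP (rho p) (b - 1) a := by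
        refine Finset.sum_le_sum fun a ha => ?_
        have hnn := mul_nonneg (hpnn b) (binomP_nonneg h0 h1 (b - 1) a)
        rw [abs_mul, abs_of_nonneg hnn, mul_assoc]
        exact mul_le_mul_of_nonneg_right (hf a b (Finset.mem_range.1 ha)) hnn
    _ = _ := by rw [← Finset.mul_sum, binomP_sum _ hb, mul_one]

lemma q_second (hpnn : ∀ k, 0 ≤ p k) (h0 : 0 ≤ rho p) (h1 : rho p ≤ 1)
    (hμ2 : HasSum (fun k : ℕ => (k : ℝ) ^ 2 * p k) μ2) :
    Summable (fun a : ℕ => (a : ℝ) ^ 2 * qfun p a) ∧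
    ∑' a : ℕ, (a : ℝ) ^ 2 * qfun p a
      = ∑' b : ℕ, ∑ a ∈ Finset.range b, (a : ℝ) ^ 2 * (p b * binomP (rho p) (b - 1) a) := by
  let G : ℕ → ℕ → ℝ := fun b a =>
    (a : ℝ) ^ 2 * if a < b then p b * binomP (rho p) (b - 1) a else 0
  have hG0 : ∀ b a, 0 ≤ G b a := by
    intro b a
    simp only [G]
    split_ifs
    · exact mul_nonneg (by positivity) (mul_nonneg (hpnn b) (binomP_nonneg h0 h1 _ _))
    · simp
  have hz : ∀ b, ∀ a ∉ Finset.range b, G b a = 0 := by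
    intro b a ha
    have : ¬ a < b := fun h => ha (Finset.mem_range.2 h)
    simp [G, this]
  have hsum : ∀ b, ∑' a, G b a
      = ∑ a ∈ Finset.range b, (a : ℝ) ^ 2 * (p b * binomP (rho p) (b - 1) a) := by
    intro b
    rw [tsum_eq_sum (hz b)]
    refine Finset.sum_congr rfl fun a ha => ?_
    simp [G, Finset.mem_range.1 ha]
  have hq : ∀ a, ∑' b, G b a = (a : ℝ) ^ 2 * qfun p a := by
    intro a
    simp only [G]
    rw [tsum_mul_left, qfun]
  have hS : Summable (Function.uncurry G) := by
    rw [summable_prod_of_nonneg (f := Function.uncurry G) (fun x => hG0 x.1 x.2)]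
    refine ⟨fun b => summable_of_ne_finset_zero (s := Finset.range b) (hz b), ?_⟩
    simp only [Function.uncurry_apply_pair]
    simp only [hsum]
    refine Summable.of_norm_bounded hμ2.summable (fun b => ?_)
    rw [Real.norm_eq_abs]
    refine y_bound hpnn h0 h1 (fun a => (a : ℝ) ^ 2) (fun a b hab => ?_) b
    rw [abs_of_nonneg (by positivity)]
    have : (a : ℝ) ≤ b := by exact_mod_cast hab.le
    gcongr
  constructor
  · have := hS.prod_symm.prod
    simp only [Prod.swap_prod_mk, Function.uncurry_apply_pair, hq] at this
    exact this
  · rw [← tsum_congr hq, ← tsum_congr hsum]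
    exact (Summable.tsum_comm hS)

lemma q_ind (a : ℕ) : qfun p a
      = ∑' b : ℕ, ∑ a' ∈ Finset.range b,
        (if a' = a then (1 : ℝ) else 0) * (p b * binomP (rho p) (b - 1) a') := by
  unfold qfun
  refine tsum_congr fun b => ?_
  simp only [ite_mul, one_mul, zero_mul]
  rw [Finset.sum_ite_eq']
  simp only [Finset.mem_range]

lemma final_conv (hd : ∀ n i, 1 ≤ dseq n i) {X : ∀ n, Finset (HE (dseq n)) → ℝ} {c : ℝ}
    (h : L1To (fun n => Om (dseq n)) X c) (Z : ∀ n, Path (dseq n) → ℝ)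
    (hZ : ∀ n, ∀ E : Path (dseq n), IsExecPath (dseq n) E → Z n E = X n (im E))
    (ε : ℝ) (hε : 0 < ε) :
    Tendsto (fun n =>
        (Nat.card {E : Path (dseq n) // IsExecPath (dseq n) E ∧ ε < |Z n E - c|} : ℝ)
          / (Nat.card {E : Path (dseq n) // IsExecPath (dseq n) E} : ℝ))
        atTop (nhds 0) := by
  refine (h.markov ε hε).congr' ?_
  filter_upwards [eventually_ge_atTop 1] with n hn
  refine (ratio_exec hn (hd n) _ _ fun E hE => ?_).symm
  rw [hZ n E hE]

end Main

/-- Concentration of the child statistics of the tree `T(dⁿ)` built by Pitman's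
additive coalescent: (i) `μ₂(q) < ∞`; (ii) `μ₂(n⁻¹ Q_{cⁿ}) → μ₂(q)` in probability
(note `μ₂(n⁻¹ Q_{cⁿ}) = n⁻¹ ∑_i cⁿ(i)²`); (iii) for `a < b`,
`n⁻¹ Pⁿ_{b,a} → p(b) P(Bin(b-1,ρ) = a)` in probability; (iv) for each `a`,
`n⁻¹ Q_{cⁿ}(a) → q(a)` in probability.  Probability at stage `n` is the uniform
distribution on the execution paths of the coalescent for `dⁿ`. -/
theorem degree_concentration
    (dseq : (n : ℕ) → Fin n → ℕ)
    (hd : ∀ n i, 1 ≤ dseq n i)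
    (heven : ∀ n, Even (∑ i, dseq n i))
    (hge : ∀ n, 2 * n ≤ ∑ i, dseq n i)
    (p : ℕ → ℝ) (hp0 : p 0 = 0) (hpnn : ∀ k, 0 ≤ p k) (hp1 : HasSum p 1)
    (hp2 : p 2 < 1)
    (μ2 : ℝ) (hμ2 : HasSum (fun k : ℕ => (k : ℝ) ^ 2 * p k) μ2) (hμ2pos : 0 < μ2)
    (hpconv : ∀ k : ℕ, Tendsto
      (fun n => (Nat.card {i : Fin n // dseq n i = k} : ℝ) / n) atTop (nhds (p k)))
    (hμ2conv : Tendsto (fun n => (∑ i, (dseq n i : ℝ) ^ 2) / n) atTop (nhds μ2)) :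
    Summable (fun a : ℕ => (a : ℝ) ^ 2 * qfun p a)
    ∧ (∀ ε : ℝ, 0 < ε → Tendsto (fun n =>
        (Nat.card {E : Path (dseq n) // IsExecPath (dseq n) E ∧
            ε < |(∑ i, (cc E i : ℝ) ^ 2) / n - ∑' a : ℕ, (a : ℝ) ^ 2 * qfun p a|} : ℝ)
          / (Nat.card {E : Path (dseq n) // IsExecPath (dseq n) E} : ℝ))
        atTop (nhds 0))
    ∧ (∀ a b : ℕ, a < b → ∀ ε : ℝ, 0 < ε → Tendsto (fun n =>
        (Nat.card {E : Path (dseq n) // IsExecPath (dseq n) E ∧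
            ε < |(Nat.card {i : Fin n // dseq n i = b ∧ cc E i = a} : ℝ) / n
                  - p b * binomP (rho p) (b - 1) a|} : ℝ)
          / (Nat.card {E : Path (dseq n) // IsExecPath (dseq n) E} : ℝ))
        atTop (nhds 0))
    ∧ (∀ a : ℕ, ∀ ε : ℝ, 0 < ε → Tendsto (fun n =>
        (Nat.card {E : Path (dseq n) // IsExecPath (dseq n) E ∧
            ε < |(Nat.card {i : Fin n // cc E i = a} : ℝ) / n - qfun p a|} : ℝ)
          / (Nat.card {E : Path (dseq n) // IsExecPath (dseq n) E} : ℝ))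
        atTop (nhds 0)) := by
  have hm := mean_lim hd hpnn hμ2 hpconv hμ2conv
  have hmu := mu1_ge hd hge hm
  have h0 : 0 ≤ rho p := by
    unfold rho
    exact div_nonneg zero_le_one (by linarith)
  have h1 : rho p ≤ 1 := by
    unfold rho
    rw [div_le_one (by linarith)]
    linarith
  have hP := fun a b hab => pab_lim hd hge hm hpconv a b hab
  have hsq : ∀ a b : ℕ, a < b → |(a : ℝ) ^ 2| ≤ (b : ℝ) ^ 2 := by
    intro a b hab
    rw [abs_of_nonneg (by positivity)]
    have : (a : ℝ) ≤ b := by exact_mod_cast hab.le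
    gcongr
  obtain ⟨q1, q2⟩ := q_second hpnn h0 h1 hμ2
  refine ⟨q1, ?_, ?_, ?_⟩
  · intro ε hε
    rw [q2]
    refine final_conv hd (f_lim hd hpnn hμ2 hpconv hμ2conv hP (fun a => (a : ℝ) ^ 2) hsq
      (y_bound hpnn h0 h1 _ hsq)) (fun n E => (∑ i, (cc E i : ℝ) ^ 2) / n) ?_ ε hε
    intro n E hE
    simp only [cc_eq hE]
  · intro a b hab ε hε
    refine final_conv hd (hP a b hab)
      (fun n E => (Nat.card {i : Fin n // dseq n i = b ∧ cc E i = a} : ℝ) / n) ?_ ε hε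
    intro n E hE
    simp only [cc_eq hE]
  · intro a ε hε
    rw [q_ind]
    have hi : ∀ a' b : ℕ, a' < b → |if a' = a then (1 : ℝ) else 0| ≤ (b : ℝ) ^ 2 := by
      intro a' b hab
      have : (1 : ℝ) ≤ b := by exact_mod_cast (by omega : 1 ≤ b)
      split_ifs
      · rw [abs_one]; nlinarith
      · rw [abs_zero]; positivity
    refine final_conv hd (f_lim hd hpnn hμ2 hpconv hμ2conv hP
      (fun a' => if a' = a then (1 : ℝ) else 0) hi (y_bound hpnn h0 h1 _ hi))
      (fun n E => (Nat.card {i : Fin n // cc E i = a} : ℝ) / n) ?_ ε hε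
    intro n E hE
    simp only [cc_eq hE]
    rw [Nat.card_eq_fintype_card, Fintype.card_subtype, Finset.sum_boole]

end TWG
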